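/- Let K be an abstract simplicial complex on [m] and J = (j_1,…,j_m) an m-tuple of positive integers. Then the cohomology rings H*(R*_K(J)) and H*(R*_{K(J)}) are isomorphic as graded rings, where R*_{K(J)} denotes R*_{K(J)}(𝟏) for the constant tuple 𝟏 = (1,…,1) of length d(J). -/

import Mathlib

set_option synthInstance.maxHeartbeats 1000000
set_option maxHeartbeats 1000000

structure ASC (m : ℕ) where
  faces : Set (Finset (Fin m))
  empty_mem : ∅ ∈ faces
  down_closed : ∀ {σ τ : Finset (Fin m)}, σ ∈ faces → τ ⊆ σ → τ ∈ faces

variable {n : ℕ}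

/-- index of the square-free monomials `ṽ^σ ũ^τ`. -/
def MonIdx (F : Set (Finset (Fin n))) : Type :=
  {p : Finset (Fin n) × Finset (Fin n) // p.1 ∈ F ∧ Disjoint p.1 p.2}

/-- the free `ℤ`-module on the square-free monomials: the underlying module of `R*_K(J)`. -/
abbrev RMod (F : Set (Finset (Fin n))) : Type := MonIdx F →₀ ℤ

/-- degree of `ṽ^σ ũ^τ` : `∑_{i∈σ} j_i + ∑_{i∈τ} (j_i - 1)`. -/
def degMon (J : Fin n → ℕ) {F : Set (Finset (Fin n))} (b : MonIdx F) : ℕ :=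
  ∑ i ∈ b.1.1, J i + ∑ i ∈ b.1.2, (J i - 1)

open Classical in
/-- the differential of `R*_K(J)`, determined by `dũ^i = ṽ^i`, `dṽ^i = 0` and the
graded Leibniz rule. -/
noncomputable def dR (F : Set (Finset (Fin n))) (J : Fin n → ℕ) :
    RMod F →ₗ[ℤ] RMod F :=
  Finsupp.lift (RMod F) ℤ (MonIdx F) fun b =>
    ∑ i ∈ b.1.2,
      if h : insert i b.1.1 ∈ F then
        ((-1 : ℤ) ^ (∑ k ∈ b.1.1.filter (fun k => k < i), J k +
            ∑ k ∈ b.1.2.filter (fun k => k < i), (J k - 1))) •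
          Finsupp.single (⟨(insert i b.1.1, b.1.2.erase i),
            ⟨h, by
              refine Finset.disjoint_left.2 fun a ha hb => ?_
              rcases Finset.mem_insert.1 ha with h' | h'
              · exact (Finset.mem_erase.1 hb).1 h'
              · exact (Finset.disjoint_left.1 b.2.2 h') (Finset.mem_of_mem_erase hb)⟩⟩ :
              MonIdx F) (1 : ℤ)
      else 0

open Classical in
/-- product of two square-free monomials, with the Koszul sign obtained by sorting the
concatenated word, together with the defining relations of `R*(J)` and the
Stanley–Reisner relations. -/
noncomputable def mulMon (F : Set (Finset (Fin n))) (J : Fin n → ℕ)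
    (a b : MonIdx F) : RMod F :=
  if h : (a.1.1 ∪ b.1.1) ∈ F ∧ Disjoint a.1.1 b.1.1 ∧ Disjoint a.1.2 b.1.1 ∧
      (∀ i ∈ (a.1.1 ∩ b.1.2) ∪ (a.1.2 ∩ b.1.2), J i = 1) then
    ((-1 : ℤ) ^ (∑ i ∈ a.1.1 ∪ a.1.2, ∑ k ∈ (b.1.1 ∪ b.1.2).filter (fun k => k < i),
        (if i ∈ a.1.1 then J i else J i - 1) * (if k ∈ b.1.1 then J k else J k - 1))) •
      Finsupp.single (⟨(a.1.1 ∪ b.1.1, (a.1.2 ∪ b.1.2) \ (a.1.1 ∪ b.1.1)),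
        ⟨h.1, Finset.disjoint_sdiff⟩⟩ : MonIdx F) (1 : ℤ)
  else 0

/-- the product on the model of `R*_K(J)`, extended bilinearly -/
noncomputable def mulR (F : Set (Finset (Fin n))) (J : Fin n → ℕ) :
    RMod F →ₗ[ℤ] RMod F →ₗ[ℤ] RMod F :=
  Finsupp.lift (RMod F →ₗ[ℤ] RMod F) ℤ (MonIdx F) fun a =>
    Finsupp.lift (RMod F) ℤ (MonIdx F) fun b => mulMon F J a b

open Classical in
/-- the unit monomial (the empty word) -/
noncomputable def oneR (F : Set (Finset (Fin n))) : RMod F :=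
  if h : ∅ ∈ F then
    Finsupp.single (⟨(∅, ∅), ⟨h, by simp⟩⟩ : MonIdx F) (1 : ℤ)
  else 0

open Classical in
noncomputable def partSub {ι α : Type*} (f : ι → α) (a : α) : Submodule ℤ (ι →₀ ℤ) where
  carrier := {x | ∀ b ∈ x.support, f b = a}
  add_mem' := by
    intro x y hx hy b hb
    rcases Finset.mem_union.1 (Finsupp.support_add hb) with h | h
    · exact hx b h
    · exact hy b h
  zero_mem' := by intro b hb; simp at hb
  smul_mem' := by
    intro c x hx b hb
    exact hx b (Finsupp.support_smul hb)

/-- `d(J) = ∑ j_i` -/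
def dJ {m : ℕ} (J : Fin m → ℕ) : ℕ := ∑ i, J i

/-- the block `B_i ⊆ [d(J)]`. -/
def Bblk {m : ℕ} (J : Fin m → ℕ) (i : Fin m) : Finset (Fin (dJ J)) :=
  Finset.univ.filter fun r =>
    (∑ k ∈ Finset.Iio i, J k) ≤ (r : ℕ) ∧ (r : ℕ) < ∑ k ∈ Finset.Iic i, J k

/-- `τ` is a missing face of `K`. -/
def IsMissingFace {m : ℕ} (K : ASC m) (τ : Finset (Fin m)) : Prop :=
  τ ∉ K.faces ∧ ∀ s ⊂ τ, s ∈ K.faces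

/-- the faces of `K(J)`. -/
def KJfaces {m : ℕ} (K : ASC m) (J : Fin m → ℕ) : Set (Finset (Fin (dJ J))) :=
  {σ | ∀ τ : Finset (Fin m), IsMissingFace K τ → ¬ (τ.biUnion (Bblk J) ⊆ σ)}


section helpers

open Finset

open Classical in
/-- raw monomial, zero if the index is not admissible -/
noncomputable def mkR {N : ℕ} (F : Set (Finset (Fin N))) (σ τ : Finset (Fin N)) : RMod F :=
  if h : σ ∈ F ∧ Disjoint σ τ then Finsupp.single (⟨(σ, τ), h⟩ : MonIdx F) (1 : ℤ) else 0

theorem mkR_idx {N : ℕ} {F : Set (Finset (Fin N))} (b : MonIdx F) :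
    mkR F b.1.1 b.1.2 = Finsupp.single b 1 := by
  unfold mkR
  rw [dif_pos b.2]
  rfl

theorem mkR_of_notMem {N : ℕ} {F : Set (Finset (Fin N))} {σ τ : Finset (Fin N)} (h : σ ∉ F) :
    mkR F σ τ = 0 := by
  unfold mkR
  rw [dif_neg (fun h' => h h'.1)]

theorem mkR_pos {N : ℕ} {F : Set (Finset (Fin N))} {σ τ : Finset (Fin N)} (h : σ ∈ F)
    (h' : Disjoint σ τ) : mkR F σ τ = Finsupp.single (⟨(σ, τ), h, h'⟩ : MonIdx F) (1 : ℤ) := by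
  exact dif_pos (⟨h, h'⟩ : σ ∈ F ∧ Disjoint σ τ)

theorem exists_idx {N : ℕ} {F : Set (Finset (Fin N))} {σ τ : Finset (Fin N)} (h : σ ∈ F)
    (h' : Disjoint σ τ) : ∃ b : MonIdx F, b.1.1 = σ ∧ b.1.2 = τ :=
  ⟨⟨(σ, τ), h, h'⟩, rfl, rfl⟩

theorem disj_ins {N : ℕ} {σ τ : Finset (Fin N)} (h : Disjoint σ τ) (i : Fin N) :
    Disjoint (insert i σ) (τ.erase i) := by
  rw [Finset.disjoint_left] at *
  grind

theorem disj_ers {N : ℕ} {σ τ : Finset (Fin N)} (h : Disjoint σ τ) (i : Fin N) :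
    Disjoint (σ.erase i) (insert i τ) := by
  rw [Finset.disjoint_left] at *
  grind

/-- linear extension -/
theorem lift_single {N : ℕ} {F : Set (Finset (Fin N))} {M : Type*} [AddCommGroup M]
    (g : MonIdx F → M) (b : MonIdx F) :
    Finsupp.lift M ℤ (MonIdx F) g (Finsupp.single b 1) = g b := by
  simp

theorem dR_single {N : ℕ} (F : Set (Finset (Fin N))) (J : Fin N → ℕ) (b : MonIdx F) :
    dR F J (Finsupp.single b 1) = ∑ i ∈ b.1.2,
      ((-1 : ℤ) ^ (∑ k ∈ b.1.1.filter (fun k => k < i), J k +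
            ∑ k ∈ b.1.2.filter (fun k => k < i), (J k - 1))) •
        mkR F (insert i b.1.1) (b.1.2.erase i) := by
  unfold dR
  rw [lift_single]
  refine Finset.sum_congr rfl fun i _ => ?_
  by_cases h : insert i b.1.1 ∈ F
  · refine (dif_pos h).trans ?_
    rw [mkR_pos h (disj_ins b.2.2 i)]
    rfl
  · refine (dif_neg h).trans ?_
    rw [mkR_of_notMem h, smul_zero]

theorem mulR_single {N : ℕ} (F : Set (Finset (Fin N))) (J : Fin N → ℕ) (a b : MonIdx F) :
    mulR F J (Finsupp.single a 1) (Finsupp.single b 1) = mulMon F J a b := by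
  unfold mulR
  rw [lift_single, lift_single]

/-- the sign -/
def sg {N : ℕ} (σ : Finset (Fin N)) (r : Fin N) : ℤ := (-1) ^ #(σ.filter (fun k => k < r))

theorem sg_mul_self {N : ℕ} (σ : Finset (Fin N)) (r : Fin N) : sg σ r * sg σ r = 1 := by
  unfold sg
  rw [← pow_add, Even.neg_one_pow ⟨_, rfl⟩]

theorem sg_insert {N : ℕ} (σ : Finset (Fin N)) (r s : Fin N) (h : r ∉ σ) :
    sg (insert r σ) s = if r < s then - sg σ s else sg σ s := by
  unfold sg
  rw [Finset.filter_insert]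
  split_ifs with hlt
  · rw [Finset.card_insert_of_notMem (by simp [h]), pow_succ]
    ring
  · rfl

theorem sg_insert_self {N : ℕ} (σ : Finset (Fin N)) (r : Fin N) (h : r ∉ σ) :
    sg (insert r σ) r = sg σ r := by
  rw [sg_insert _ _ _ h]
  simp

theorem sg_swap {N : ℕ} (σ : Finset (Fin N)) (r s : Fin N) (hr : r ∉ σ) (hs : s ∉ σ)
    (hrs : r ≠ s) : sg σ r * sg (insert r σ) s = - (sg σ s * sg (insert s σ) r) := by
  rw [sg_insert _ _ _ hr, sg_insert _ _ _ hs]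
  rcases lt_or_gt_of_ne hrs with h | h
  · rw [if_pos h, if_neg (not_lt.2 h.le)]
    ring
  · rw [if_pos h, if_neg (not_lt.2 h.le)]
    ring

theorem sg_swap2 {N : ℕ} (σ : Finset (Fin N)) (r s : Fin N) (hr : r ∉ σ) (hs : s ∉ σ)
    (hrs : r ≠ s) : sg σ r * sg σ s = - (sg (insert r σ) s * sg (insert s σ) r) := by
  rw [sg_insert _ _ _ hr, sg_insert _ _ _ hs]
  rcases lt_or_gt_of_ne hrs with h | h
  · rw [if_pos h, if_neg (not_lt.2 h.le)]
    ring
  · rw [if_pos h, if_neg (not_lt.2 h.le)]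
    ring

/-- the differential for the constant tuple one -/
theorem dR_mk {N : ℕ} (F : Set (Finset (Fin N)))
    (hF : ∀ σ τ : Finset (Fin N), σ ∈ F → τ ⊆ σ → τ ∈ F) (σ τ : Finset (Fin N))
    (h : Disjoint σ τ) :
    dR F (fun _ => 1) (mkR F σ τ) = ∑ i ∈ τ, sg σ i • mkR F (insert i σ) (τ.erase i) := by
  by_cases hσ : σ ∈ F
  · obtain ⟨b, rfl, rfl⟩ := exists_idx hσ h
    rw [mkR_idx, dR_single]
    refine Finset.sum_congr rfl fun i _ => ?_
    simp [sg]
  · rw [mkR_of_notMem hσ, map_zero]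
    symm
    refine Finset.sum_eq_zero fun i _ => ?_
    rw [mkR_of_notMem (fun h' => hσ (hF _ _ h' (Finset.subset_insert _ _))), smul_zero]

theorem hom_ext_mk {N : ℕ} {F : Set (Finset (Fin N))} {M : Type*} [AddCommGroup M]
    {f g : RMod F →ₗ[ℤ] M}
    (h : ∀ σ τ, σ ∈ F → Disjoint σ τ → f (mkR F σ τ) = g (mkR F σ τ)) : f = g := by
  refine Finsupp.lhom_ext' fun b => LinearMap.ext_ring ?_
  have := h b.1.1 b.1.2 b.2.1 b.2.2
  rw [mkR_idx] at this
  exact this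

theorem dR_dR {N : ℕ} (F : Set (Finset (Fin N)))
    (hF : ∀ σ τ : Finset (Fin N), σ ∈ F → τ ⊆ σ → τ ∈ F) (x : RMod F) :
    dR F (fun _ => 1) (dR F (fun _ => 1) x) = 0 := by
  have : (dR F (fun _ => 1)) ∘ₗ (dR F (fun _ => 1)) = 0 := by
    refine hom_ext_mk fun σ τ _ h => ?_
    rw [LinearMap.comp_apply, dR_mk F hF _ _ h, map_sum, LinearMap.zero_apply]
    have e : ∀ i ∈ τ, dR F (fun _ => 1) (sg σ i • mkR F (insert i σ) (τ.erase i)) =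
        ∑ j ∈ τ.erase i, (sg σ i * sg (insert i σ) j) •
          mkR F (insert j (insert i σ)) ((τ.erase i).erase j) := by
      intro i hi
      rw [map_smul, dR_mk F hF _ _ (disj_ins h i), Finset.smul_sum]
      refine Finset.sum_congr rfl fun j _ => ?_
      rw [smul_smul]
    rw [Finset.sum_congr rfl e]
    rw [← self_eq_neg]
    conv_lhs => rw [Finset.sum_comm' (t' := τ) (s' := fun j => τ.erase j) (by grind)]
    rw [← Finset.sum_neg_distrib]
    refine Finset.sum_congr rfl fun i hi => ?_
    rw [← Finset.sum_neg_distrib]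
    refine Finset.sum_congr rfl fun j hj => ?_
    have hj' := Finset.mem_erase.1 hj
    rw [sg_swap σ j i (Finset.disjoint_right.1 h hj'.2) (Finset.disjoint_right.1 h hi) hj'.1,
      neg_smul, Finset.erase_right_comm, Finset.insert_comm]
  exact LinearMap.congr_fun this x

/-- combinatorial data of the blocks -/
structure BData {m D : ℕ} (J : Fin m → ℕ) (F : Set (Finset (Fin m)))
    (F' : Set (Finset (Fin D))) where
  blk : Fin D → Fin m
  fst : Fin m → Fin D
  mono : Monotone blk
  blk_fst : ∀ i, blk (fst i) = i
  fst_le : ∀ r, fst (blk r) ≤ r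
  card_blk : ∀ i, #(univ.filter fun r => blk r = i) = J i
  down : ∀ σ τ : Finset (Fin m), σ ∈ F → τ ⊆ σ → τ ∈ F
  mem_iff : ∀ σ, σ ∈ F' ↔ (univ.filter fun i => ∀ r, blk r = i → r ∈ σ) ∈ F

namespace BData

variable {m D : ℕ} {J : Fin m → ℕ} {F : Set (Finset (Fin m))} {F' : Set (Finset (Fin D))}
  (B : BData J F F')

theorem down' (B : BData J F F') : ∀ σ τ : Finset (Fin D), σ ∈ F' → τ ⊆ σ → τ ∈ F' := by
  intro σ τ h hs
  rw [B.mem_iff] at *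
  refine B.down _ _ h fun i hi => ?_
  simp only [Finset.mem_filter, Finset.mem_univ, true_and] at *
  exact fun r hr => hs (hi r hr)

/-- the block `i` of the monomial is of image type -/
def good (i : Fin m) (σ S : Finset (Fin D)) : Prop :=
  (∀ r ∈ S, B.blk r ≠ i) ∨ (∀ r, B.blk r = i → r ∈ S ∧ (r ≠ B.fst i → r ∈ σ))

open Classical in
noncomputable def piv (i : Fin m) (S : Finset (Fin D)) : Fin D :=
  if B.fst i ∈ S then B.fst i else
    if h : ∃ r, r ∈ S ∧ B.blk r = i then h.choose else B.fst i

theorem piv_spec {i : Fin m} {σ S : Finset (Fin D)} (h : ¬ B.good i σ S) :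
    B.piv i S ∈ S ∧ B.blk (B.piv i S) = i := by
  unfold piv
  split_ifs with h1 h2
  · exact ⟨h1, B.blk_fst i⟩
  · exact h2.choose_spec
  · exfalso
    apply h
    left
    intro r hr hri
    exact h2 ⟨r, hr, hri⟩

theorem piv_fst {i : Fin m} {S : Finset (Fin D)} (h : B.fst i ∈ S) :
    B.piv i S = B.fst i := by
  unfold piv
  rw [if_pos h]

theorem blk_piv (i : Fin m) (S : Finset (Fin D)) : B.blk (B.piv i S) = i := by
  unfold piv
  split_ifs with h1 h2
  · exact B.blk_fst i
  · exact h2.choose_spec.2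
  · exact B.blk_fst i

theorem good_mono {i : Fin m} {σ σ' S : Finset (Fin D)} (h : B.good i σ S) (hs : σ ⊆ σ') :
    B.good i σ' S := by
  rcases h with h | h
  · exact Or.inl h
  · exact Or.inr fun r hr => ⟨(h r hr).1, fun h' => hs ((h r hr).2 h')⟩

theorem good_erase {i : Fin m} {σ S : Finset (Fin D)} (h : B.good i σ S) :
    B.good i (σ.erase (B.piv i S)) S := by
  rcases h with h | h
  · exact Or.inl h
  · refine Or.inr fun r hr => ⟨(h r hr).1, fun h' => ?_⟩
    rw [B.piv_fst (h _ (B.blk_fst i)).1]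
    exact Finset.mem_erase.2 ⟨h', (h r hr).2 h'⟩

theorem good_erase_ne {i k : Fin m} {σ S : Finset (Fin D)} (hk : k ≠ i) (h : B.good k σ S) :
    B.good k (σ.erase (B.piv i S)) S := by
  rcases h with h | h
  · exact Or.inl h
  · refine Or.inr fun r hr => ⟨(h r hr).1, fun h' => ?_⟩
    refine Finset.mem_erase.2 ⟨?_, (h r hr).2 h'⟩
    rintro rfl
    exact hk (hr.symm.trans (B.blk_piv i S))

/-- badness does not depend on the letter at the pivot -/
theorem bad_erase {i : Fin m} {σ S : Finset (Fin D)} (h : B.good i (σ.erase (B.piv i S)) S) :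
    B.good i σ S := B.good_mono h (Finset.erase_subset _ _)

theorem mem_erase_iff {i : Fin m} {σ S : Finset (Fin D)} (hS : σ ⊆ S) (h : ¬ B.good i σ S) :
    σ.erase (B.piv i S) ∈ F' ↔ σ ∈ F' := by
  rw [B.mem_iff, B.mem_iff]
  have : (univ.filter fun k => ∀ r, B.blk r = k → r ∈ σ.erase (B.piv i S)) =
      (univ.filter fun k => ∀ r, B.blk r = k → r ∈ σ) := by
    ext k
    simp only [Finset.mem_filter, Finset.mem_univ, true_and]
    constructor
    · exact fun h r hr => Finset.mem_of_mem_erase (h r hr)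
    · intro h' r hr
      refine Finset.mem_erase.2 ⟨?_, h' r hr⟩
      rintro rfl
      rw [B.blk_piv] at hr
      subst hr
      exact h (Or.inr fun r hr => ⟨hS (h' r hr), fun _ => h' r hr⟩)
  rw [this]

open Classical in
/-- the homotopy -/
noncomputable def hh (i : Fin m) : RMod F' →ₗ[ℤ] RMod F' :=
  Finsupp.lift (RMod F') ℤ (MonIdx F') fun b =>
    if ¬ B.good i b.1.1 (b.1.1 ∪ b.1.2) ∧ B.piv i (b.1.1 ∪ b.1.2) ∈ b.1.1 then
      sg b.1.1 (B.piv i (b.1.1 ∪ b.1.2)) • mkR F' (b.1.1.erase (B.piv i (b.1.1 ∪ b.1.2)))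
        (insert (B.piv i (b.1.1 ∪ b.1.2)) b.1.2)
    else 0

open Classical in
theorem hh_mk (i : Fin m) (σ τ S : Finset (Fin D)) (h : Disjoint σ τ) (hS : S = σ ∪ τ) :
    B.hh i (mkR F' σ τ) = if ¬ B.good i σ S ∧ B.piv i S ∈ σ then
      sg σ (B.piv i S) • mkR F' (σ.erase (B.piv i S)) (insert (B.piv i S) τ) else 0 := by
  subst hS
  by_cases hσ : σ ∈ F'
  · obtain ⟨b, rfl, rfl⟩ := exists_idx hσ h
    rw [mkR_idx, hh, lift_single]
  · rw [mkR_of_notMem hσ, map_zero]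
    symm
    split_ifs with hc
    · rw [mkR_of_notMem, smul_zero]
      rw [B.mem_erase_iff Finset.subset_union_left hc.1]
      exact hσ
    · rfl

/-- span of the monomials that are good at `A` -/
noncomputable def V (Q : ℕ → Prop) (A : Finset (Fin m)) : Submodule ℤ (RMod F') :=
  Submodule.span ℤ {x | ∃ σ τ, Disjoint σ τ ∧ Q #σ ∧ (∀ i ∈ A, B.good i σ (σ ∪ τ)) ∧
    x = mkR F' σ τ}

theorem hh_V {Q : ℕ → Prop} {A : Finset (Fin m)} {i : Fin m} (hi : i ∈ A) {x : RMod F'}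
    (hx : x ∈ B.V Q A) : B.hh i x = 0 := by
  have : B.V Q A ≤ LinearMap.ker (B.hh i) := by
    refine Submodule.span_le.2 ?_
    rintro _ ⟨σ, τ, h, -, hg, rfl⟩
    rw [SetLike.mem_coe, LinearMap.mem_ker, B.hh_mk i σ τ _ h rfl, if_neg]
    exact fun h' => h'.1 (hg i hi)
  exact this hx

/-- `1 - dh - hd` on a monomial -/
theorem P_mk {Q : ℕ → Prop} {A : Finset (Fin m)} (i : Fin m) (σ τ : Finset (Fin D))
    (h : Disjoint σ τ) (hQ : Q #σ) (hA : ∀ k ∈ A, B.good k σ (σ ∪ τ)) :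
    mkR F' σ τ - dR F' (fun _ => 1) (B.hh i (mkR F' σ τ)) -
      B.hh i (dR F' (fun _ => 1) (mkR F' σ τ)) ∈ B.V Q (insert i A) := by
  classical
  have hS : ∀ r ∈ τ, σ ∪ τ = insert r σ ∪ τ.erase r := by
    intro r hr
    ext k
    grind
  have hd : B.hh i (dR F' (fun _ => 1) (mkR F' σ τ)) = ∑ r ∈ τ, sg σ r •
      B.hh i (mkR F' (insert r σ) (τ.erase r)) := by
    rw [dR_mk F' B.down' _ _ h, map_sum]
    simp_rw [map_smul]
  by_cases hg : B.good i σ (σ ∪ τ)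
  · have h1 : B.hh i (mkR F' σ τ) = 0 := by
      rw [B.hh_mk i σ τ _ h rfl, if_neg (fun h' => h'.1 hg)]
    have h2 : B.hh i (dR F' (fun _ => 1) (mkR F' σ τ)) = 0 := by
      rw [hd]
      refine Finset.sum_eq_zero fun r hr => ?_
      rw [B.hh_mk i _ _ _ (disj_ins h r) (hS r hr), if_neg, smul_zero]
      exact fun h' => h'.1 (B.good_mono hg (Finset.subset_insert _ _))
    rw [h1, h2, map_zero, sub_zero, sub_zero]
    refine Submodule.subset_span ⟨σ, τ, h, hQ, ?_, rfl⟩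
    intro k hk
    rcases Finset.mem_insert.1 hk with rfl | hk
    · exact hg
    · exact hA k hk
  · obtain ⟨hpS, hpb⟩ := B.piv_spec hg
    by_cases hp : B.piv i (σ ∪ τ) ∈ σ
    · have h1 := B.hh_mk i σ τ _ h rfl
      rw [if_pos ⟨hg, hp⟩] at h1
      rw [hd, h1]
      have hterm : ∀ r ∈ τ, sg σ r • B.hh i (mkR F' (insert r σ) (τ.erase r)) =
          if ¬ B.good i (insert r σ) (σ ∪ τ) then
            (sg σ r * sg (insert r σ) (B.piv i (σ ∪ τ))) •
              mkR F' ((insert r σ).erase (B.piv i (σ ∪ τ)))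
                (insert (B.piv i (σ ∪ τ)) (τ.erase r)) else 0 := by
        intro r hr
        rw [B.hh_mk i _ _ _ (disj_ins h r) (hS r hr)]
        by_cases hgr : B.good i (insert r σ) (σ ∪ τ)
        · rw [if_neg (fun h' => h'.1 hgr), if_neg (fun h' => h' hgr), smul_zero]
        · rw [if_pos ⟨hgr, Finset.mem_insert_of_mem hp⟩, if_pos hgr, smul_smul]
      rw [Finset.sum_congr rfl hterm]
      have hpg : ∀ k ∈ A, k ≠ i → B.good k (σ.erase (B.piv i (σ ∪ τ))) (σ ∪ τ) :=
        fun k hk hki => B.good_erase_ne hki (hA k hk)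
      have hbad' : ∀ r, B.good i (insert r σ) (σ ∪ τ) →
        B.good i ((insert r σ).erase (B.piv i (σ ∪ τ))) (σ ∪ τ) := fun r hr => B.good_erase hr
      generalize B.piv i (σ ∪ τ) = p at *
      have hpτ : p ∉ τ := Finset.disjoint_left.1 h hp
      obtain ⟨σ0, hp0, rfl⟩ : ∃ σ0, p ∉ σ0 ∧ σ = insert p σ0 :=
        ⟨σ.erase p, Finset.notMem_erase _ _, (Finset.insert_erase hp).symm⟩
      have hdd : Disjoint σ0 (insert p τ) := by
        have := disj_ers h p
        rwa [Finset.erase_insert hp0] at this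
      rw [map_smul, Finset.erase_insert hp0, dR_mk F' B.down' _ _ hdd,
        Finset.sum_insert hpτ, Finset.erase_insert hpτ, smul_add, smul_smul,
        sg_insert_self _ _ hp0, sg_mul_self, one_smul, sub_add_cancel_left,
        Finset.smul_sum, sub_eq_add_neg, ← neg_add, ← Finset.sum_add_distrib]
      refine Submodule.neg_mem _ (Submodule.sum_mem _ fun r hr => ?_)
      have hr0 : r ∉ insert p σ0 := Finset.disjoint_right.1 h hr
      have hrp : p ≠ r := by
        rintro rfl
        exact hpτ hr
      have hr1 : r ∉ σ0 := fun h => hr0 (Finset.mem_insert_of_mem h)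
      have e1 : (insert p τ).erase r = insert p (τ.erase r) := by
        rw [Finset.erase_insert_of_ne hrp]
      have e2 : (insert r (insert p σ0)).erase p = insert r σ0 := by
        grind
      by_cases hgr : B.good i (insert r (insert p σ0)) (insert p σ0 ∪ τ)
      · rw [if_neg (fun h' => h' hgr), add_zero, smul_smul]
        refine Submodule.smul_mem _ _ (Submodule.subset_span
          ⟨_, _, ?_, ?_, ?_, rfl⟩)
        · exact disj_ins hdd r
        · rw [Finset.card_insert_of_notMem hr1]
          rw [Finset.card_insert_of_notMem hp0] at hQ
          exact hQ
        · have e3 : insert r σ0 ∪ (insert p τ).erase r = insert p σ0 ∪ τ := by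
            ext k
            grind
          rw [e3]
          intro k hk
          by_cases hki : k = i
          · subst hki
            have := hbad' r hgr
            rwa [e2] at this
          · have := hpg k (Finset.mem_of_mem_insert_of_ne hk hki) hki
            rw [Finset.erase_insert hp0] at this
            exact B.good_mono this (Finset.subset_insert _ _)
      · rw [if_pos hgr, e1, e2, smul_smul, ← add_smul, sg_swap2 σ0 p r hp0 hr1 hrp,
          Finset.insert_comm, sg_insert_self (insert r σ0) p (by grind), neg_add_cancel,
          zero_smul]
        exact Submodule.zero_mem _
    · have h1 : B.hh i (mkR F' σ τ) = 0 := by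
        rw [B.hh_mk i σ τ _ h rfl, if_neg (fun h' => hp h'.2)]
      have hpτ : B.piv i (σ ∪ τ) ∈ τ := by
        rcases Finset.mem_union.1 hpS with h' | h'
        · exact absurd h' hp
        · exact h'
      have h2 : B.hh i (dR F' (fun _ => 1) (mkR F' σ τ)) = mkR F' σ τ := by
        rw [hd, Finset.sum_eq_single_of_mem _ hpτ]
        · have hb : ¬ B.good i (insert (B.piv i (σ ∪ τ)) σ) (σ ∪ τ) := by
            intro hg'
            have := B.good_erase hg'
            rw [Finset.erase_insert hp] at this
            exact hg this
          rw [B.hh_mk i _ _ _ (disj_ins h _) (hS _ hpτ),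
            if_pos ⟨hb, Finset.mem_insert_self _ _⟩, smul_smul, sg_insert_self _ _ hp,
            sg_mul_self, one_smul, Finset.erase_insert hp, Finset.insert_erase hpτ]
        · intro r hr hrp
          rw [B.hh_mk i _ _ _ (disj_ins h r) (hS r hr), if_neg, smul_zero]
          rintro ⟨-, h'⟩
          rcases Finset.mem_insert.1 h' with h' | h'
          · exact hrp h'.symm
          · exact hp h'
      rw [h1, h2, map_zero, sub_zero, sub_self]
      exact Submodule.zero_mem _

theorem P_V {Q : ℕ → Prop} {A : Finset (Fin m)} (i : Fin m) {x : RMod F'}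
    (hx : x ∈ B.V Q A) :
    x - dR F' (fun _ => 1) (B.hh i x) - B.hh i (dR F' (fun _ => 1) x) ∈ B.V Q (insert i A) := by
  have : B.V Q A ≤ (B.V Q (insert i A)).comap
      (LinearMap.id - dR F' (fun _ => 1) ∘ₗ B.hh i - B.hh i ∘ₗ dR F' (fun _ => 1)) := by
    refine Submodule.span_le.2 ?_
    rintro _ ⟨σ, τ, h, hQ, hg, rfl⟩
    exact B.P_mk i σ τ h hQ hg
  exact this hx

theorem retract {Q : ℕ → Prop} {Q' : ℕ → Prop} {x : RMod F'} (hx : x ∈ B.V Q ∅)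
    (hd : dR F' (fun _ => 1) x ∈ B.V Q' univ) :
    ∃ w, x - dR F' (fun _ => 1) w ∈ B.V Q univ := by
  suffices h : ∀ A : Finset (Fin m), ∃ w, x - dR F' (fun _ => 1) w ∈ B.V Q A from h univ
  intro A
  induction A using Finset.induction_on with
  | empty => exact ⟨0, by simpa using hx⟩
  | insert i A _ ih =>
    obtain ⟨w, hw⟩ := ih
    have h := B.P_V i hw
    have e : dR F' (fun _ => 1) (x - dR F' (fun _ => 1) w) = dR F' (fun _ => 1) x := by
      rw [map_sub, dR_dR F' B.down', sub_zero]
    rw [e, B.hh_V (Finset.mem_univ i) hd, sub_zero, sub_sub, ← map_add] at h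
    exact ⟨_, h⟩


/-- the `v`-part of the image monomial -/
def vs (σ τ : Finset (Fin m)) : Finset (Fin D) :=
  univ.filter fun r => B.blk r ∈ σ ∨ (B.blk r ∈ τ ∧ r ≠ B.fst (B.blk r))

/-- the `u`-part of the image monomial -/
def us (τ : Finset (Fin m)) : Finset (Fin D) :=
  univ.filter fun r => B.blk r ∈ τ ∧ r = B.fst (B.blk r)

theorem mem_vs {σ τ : Finset (Fin m)} {r : Fin D} :
    r ∈ B.vs σ τ ↔ B.blk r ∈ σ ∨ (B.blk r ∈ τ ∧ r ≠ B.fst (B.blk r)) := by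
  simp [vs]

theorem mem_us {τ : Finset (Fin m)} {r : Fin D} :
    r ∈ B.us τ ↔ B.blk r ∈ τ ∧ r = B.fst (B.blk r) := by
  simp [us]

theorem fst_mem_vs {σ τ : Finset (Fin m)} {i : Fin m} : B.fst i ∈ B.vs σ τ ↔ i ∈ σ := by
  rw [mem_vs, B.blk_fst]
  simp

theorem fst_mem_us {τ : Finset (Fin m)} {i : Fin m} : B.fst i ∈ B.us τ ↔ i ∈ τ := by
  rw [mem_us, B.blk_fst]
  simp

theorem us_eq_image (τ : Finset (Fin m)) : B.us τ = τ.image B.fst := by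
  ext r
  rw [mem_us, Finset.mem_image]
  constructor
  · rintro ⟨h1, h2⟩
    exact ⟨_, h1, h2.symm⟩
  · rintro ⟨i, hi, rfl⟩
    rw [B.blk_fst]
    exact ⟨hi, rfl⟩

theorem fst_inj : Function.Injective B.fst := fun i k h => by
  rw [← B.blk_fst i, h, B.blk_fst]

theorem vs_disj {σ τ : Finset (Fin m)} (h : Disjoint σ τ) : Disjoint (B.vs σ τ) (B.us τ) := by
  rw [Finset.disjoint_left]
  intro r hr hr'
  rw [mem_us] at hr'
  rw [mem_vs] at hr
  rcases hr with hr | hr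
  · exact Finset.disjoint_left.1 h hr hr'.1
  · exact hr.2 hr'.2

theorem union_mem (σ τ σ' τ' : Finset (Fin m)) :
    B.vs σ τ ∪ B.vs σ' τ' ∈ F' ↔ σ ∪ σ' ∈ F := by
  rw [B.mem_iff]
  have : (univ.filter fun i => ∀ r, B.blk r = i → r ∈ B.vs σ τ ∪ B.vs σ' τ') = σ ∪ σ' := by
    ext i
    simp only [Finset.mem_filter, Finset.mem_univ, true_and, Finset.mem_union]
    constructor
    · intro h
      have := h _ (B.blk_fst i)
      rwa [fst_mem_vs, fst_mem_vs] at this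
    · rintro h r rfl
      rw [mem_vs, mem_vs]
      tauto
  rw [this]

theorem vs_mem (σ τ : Finset (Fin m)) : B.vs σ τ ∈ F' ↔ σ ∈ F := by
  have := B.union_mem σ τ σ τ
  rwa [Finset.union_self, Finset.union_self] at this

/-- the comparison map -/
noncomputable def phi : RMod F →ₗ[ℤ] RMod F' :=
  Finsupp.lift (RMod F') ℤ (MonIdx F) fun b => mkR F' (B.vs b.1.1 b.1.2) (B.us b.1.2)

theorem phi_single (b : MonIdx F) :
    B.phi (Finsupp.single b 1) = mkR F' (B.vs b.1.1 b.1.2) (B.us b.1.2) := by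
  rw [phi, lift_single]

theorem phi_mk (σ τ : Finset (Fin m)) (h : Disjoint σ τ) :
    B.phi (mkR F σ τ) = mkR F' (B.vs σ τ) (B.us τ) := by
  by_cases hσ : σ ∈ F
  · obtain ⟨b, rfl, rfl⟩ := exists_idx hσ h
    rw [mkR_idx, phi_single]
  · rw [mkR_of_notMem hσ, map_zero, mkR_of_notMem]
    rwa [B.vs_mem]

theorem card_fib (σ τ : Finset (Fin m)) (i : Fin m) (hi : i ∈ σ ∪ τ) :
    #((B.vs σ τ).filter fun r => B.blk r = i) = if i ∈ σ then J i else J i - 1 := by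
  split_ifs with h
  · rw [← B.card_blk i]
    congr 1
    ext r
    simp only [Finset.mem_filter, Finset.mem_univ, true_and, mem_vs]
    constructor
    · exact fun h => h.2
    · rintro rfl
      exact ⟨Or.inl h, rfl⟩
  · have hτ : i ∈ τ := (Finset.mem_union.1 hi).resolve_left h
    rw [← B.card_blk i, ← Finset.card_erase_of_mem (a := B.fst i) (by simp [B.blk_fst])]
    congr 1
    ext r
    simp only [Finset.mem_filter, Finset.mem_univ, true_and, mem_vs, Finset.mem_erase]
    constructor
    · rintro ⟨h1, rfl⟩
      exact ⟨(h1.resolve_left h).2, rfl⟩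
    · rintro ⟨h1, rfl⟩
      exact ⟨Or.inr ⟨hτ, h1⟩, rfl⟩

theorem sum_vs (σ τ : Finset (Fin m)) (g : Fin m → ℕ) :
    ∑ r ∈ B.vs σ τ, g (B.blk r) = ∑ i ∈ σ ∪ τ, (if i ∈ σ then J i else J i - 1) * g i := by
  rw [← Finset.sum_fiberwise_of_maps_to (t := σ ∪ τ) (g := B.blk)]
  · refine Finset.sum_congr rfl fun i hi => ?_
    rw [← B.card_fib σ τ i hi, Finset.sum_congr rfl (g := fun _ => g i)]
    · rw [Finset.sum_const, smul_eq_mul]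
    · intro r hr
      rw [(Finset.mem_filter.1 hr).2]
  · intro r hr
    rw [mem_vs] at hr
    rw [Finset.mem_union]
    tauto

theorem sum_vs' (σ τ : Finset (Fin m)) (h : Disjoint σ τ) (g : Fin m → ℕ) :
    ∑ r ∈ B.vs σ τ, g (B.blk r) = ∑ i ∈ σ, J i * g i + ∑ i ∈ τ, (J i - 1) * g i := by
  rw [sum_vs, Finset.sum_union h]
  congr 1
  · exact Finset.sum_congr rfl fun i hi => by rw [if_pos hi]
  · exact Finset.sum_congr rfl fun i hi => by rw [if_neg (Finset.disjoint_right.1 h hi)]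

theorem card_vs (σ τ : Finset (Fin m)) (h : Disjoint σ τ) :
    #(B.vs σ τ) = ∑ i ∈ σ, J i + ∑ i ∈ τ, (J i - 1) := by
  have := B.sum_vs' σ τ h (fun _ => 1)
  simpa using this

theorem lt_fst {r : Fin D} {i : Fin m} : r < B.fst i ↔ B.blk r < i := by
  constructor
  · intro h
    have h1 := B.mono h.le
    rw [B.blk_fst] at h1
    refine lt_of_le_of_ne h1 ?_
    rintro rfl
    exact absurd (B.fst_le r) (not_le.2 h)
  · intro h
    by_contra h'
    have h1 := B.mono (not_lt.1 h')
    rw [B.blk_fst] at h1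
    exact absurd h (not_lt.2 h1)

theorem phi_dR (x : RMod F) : dR F' (fun _ => 1) (B.phi x) = B.phi (dR F J x) := by
  have : dR F' (fun _ => 1) ∘ₗ B.phi = B.phi ∘ₗ dR F J := by
    refine Finsupp.lhom_ext' fun b => LinearMap.ext_ring ?_
    change dR F' (fun _ => 1) (B.phi (Finsupp.single b 1)) =
      B.phi (dR F J (Finsupp.single b 1))
    rw [phi_single, dR_single, dR_mk F' B.down' _ _ (B.vs_disj b.2.2), map_sum]
    conv_lhs => rw [us_eq_image, Finset.sum_image (fun _ _ _ _ h => B.fst_inj h)]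
    refine Finset.sum_congr rfl fun i hi => ?_
    rw [map_smul, B.phi_mk _ _ (disj_ins b.2.2 i)]
    have e1 : insert (B.fst i) (B.vs b.1.1 b.1.2) =
        B.vs (insert i b.1.1) (b.1.2.erase i) := by
      ext r
      simp only [Finset.mem_insert, mem_vs, Finset.mem_erase]
      by_cases hr : B.blk r = i
      · subst hr
        by_cases hr' : r = B.fst (B.blk r)
        · simp [← hr']
        · simp [hr', hi]
      · have : r ≠ B.fst i := by
          rintro rfl
          exact hr (B.blk_fst i)
        simp [this, hr]
    have e2 : (b.1.2.image B.fst).erase (B.fst i) = B.us (b.1.2.erase i) := by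
      rw [us_eq_image, Finset.image_erase B.fst_inj]
    rw [e1, e2]
    congr 1
    unfold sg
    congr 1
    have h2 := B.sum_vs' b.1.1 b.1.2 b.2.2 (fun k => if k < i then 1 else 0)
    simp only [mul_ite, mul_one, mul_zero, ← Finset.sum_filter] at h2
    rw [← h2]
    simp only [lt_fst, Finset.card_eq_sum_ones]
  exact LinearMap.congr_fun this x

open Classical in
theorem mulMon_eq {N : ℕ} (F : Set (Finset (Fin N))) (J : Fin N → ℕ) (a b : MonIdx F) :
    mulMon F J a b =
  if (a.1.1 ∪ b.1.1) ∈ F ∧ Disjoint a.1.1 b.1.1 ∧ Disjoint a.1.2 b.1.1 ∧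
      (∀ i ∈ (a.1.1 ∩ b.1.2) ∪ (a.1.2 ∩ b.1.2), J i = 1) then
    ((-1 : ℤ) ^ (∑ i ∈ a.1.1 ∪ a.1.2, ∑ k ∈ (b.1.1 ∪ b.1.2).filter (fun k => k < i),
        (if i ∈ a.1.1 then J i else J i - 1) * (if k ∈ b.1.1 then J k else J k - 1))) •
      mkR F (a.1.1 ∪ b.1.1) ((a.1.2 ∪ b.1.2) \ (a.1.1 ∪ b.1.1)) else 0 := by
  unfold mulMon
  by_cases h : (a.1.1 ∪ b.1.1) ∈ F ∧ Disjoint a.1.1 b.1.1 ∧ Disjoint a.1.2 b.1.1 ∧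
      (∀ i ∈ (a.1.1 ∩ b.1.2) ∪ (a.1.2 ∩ b.1.2), J i = 1)
  · refine (dif_pos h).trans ?_
    rw [if_pos h, mkR_pos h.1 Finset.disjoint_sdiff]
    rfl
  · refine (dif_neg h).trans ?_
    rw [if_neg h]

theorem J_one {i : Fin m} : J i = 1 ↔ ∀ r, B.blk r = i → r = B.fst i := by
  rw [← B.card_blk i, Finset.card_eq_one]
  constructor
  · rintro ⟨a, ha⟩ r hr
    have h1 : r ∈ univ.filter fun r => B.blk r = i := by simp [hr]
    have h2 : B.fst i ∈ univ.filter fun r => B.blk r = i := by simp [B.blk_fst]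
    rw [ha, Finset.mem_singleton] at h1 h2
    rw [h1, h2]
  · intro h
    refine ⟨B.fst i, ?_⟩
    ext r
    simp only [Finset.mem_filter, Finset.mem_univ, true_and, Finset.mem_singleton]
    constructor
    · exact h r
    · rintro rfl
      exact B.blk_fst i

theorem cond_iff (σ τ σ' τ' : Finset (Fin m)) :
    (B.vs σ τ ∪ B.vs σ' τ' ∈ F' ∧ Disjoint (B.vs σ τ) (B.vs σ' τ') ∧
      Disjoint (B.us τ) (B.vs σ' τ') ∧
      ∀ i ∈ (B.vs σ τ ∩ B.us τ') ∪ (B.us τ ∩ B.us τ'), (fun _ => 1 : Fin D → ℕ) i = 1) ↔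
    (σ ∪ σ' ∈ F ∧ Disjoint σ σ' ∧ Disjoint τ σ' ∧ ∀ i ∈ (σ ∩ τ') ∪ (τ ∩ τ'), J i = 1) := by
  rw [B.union_mem]
  refine and_congr_right fun _ => ?_
  simp only [Finset.disjoint_left]
  constructor
  · rintro ⟨h1, h2, -⟩
    refine ⟨fun i hi hi' => ?_, fun i hi hi' => ?_, fun i hi => ?_⟩
    · exact h1 (B.fst_mem_vs.2 hi) (B.fst_mem_vs.2 hi')
    · exact h2 (B.fst_mem_us.2 hi) (B.fst_mem_vs.2 hi')
    · rw [B.J_one]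
      rintro r rfl
      by_contra hr
      refine @h1 r ?_ ?_ <;> rw [mem_vs] <;>
        simp only [Finset.mem_union, Finset.mem_inter] at hi <;> tauto
  · rintro ⟨h1, h2, h3⟩
    refine ⟨fun r hr hr' => ?_, fun r hr hr' => ?_, fun _ _ => trivial⟩
    · rw [mem_vs] at hr hr'
      have h3' := h3 (B.blk r)
      rw [B.J_one] at h3'
      simp only [Finset.mem_union, Finset.mem_inter] at h3'
      have h4 := @h1 (B.blk r)
      have h5 := @h2 (B.blk r)
      have h6 : r ≠ B.fst (B.blk r) → ¬ ∀ r', B.blk r' = B.blk r → r' = B.fst (B.blk r) :=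
        fun h h' => h (h' r rfl)
      tauto
    · rw [mem_us] at hr
      rw [mem_vs] at hr'
      have h5 := @h2 (B.blk r)
      tauto

theorem sign_eq (σ τ σ' τ' : Finset (Fin m)) (h1 : Disjoint σ σ') (h2 : Disjoint τ σ')
    (h3 : ∀ i ∈ (σ ∩ τ') ∪ (τ ∩ τ'), J i = 1) :
    (∑ r ∈ B.vs σ τ ∪ B.us τ, ∑ s ∈ (B.vs σ' τ' ∪ B.us τ').filter (fun s => s < r),
      (if r ∈ B.vs σ τ then 1 else 1 - 1) * (if s ∈ B.vs σ' τ' then 1 else 1 - 1)) =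
    ∑ i ∈ σ ∪ τ, ∑ k ∈ (σ' ∪ τ').filter (fun k => k < i),
        (if i ∈ σ then J i else J i - 1) * (if k ∈ σ' then J k else J k - 1) := by
  simp only [← Finset.mul_sum]
  rw [← B.sum_vs σ τ
    (fun i => ∑ k ∈ (σ' ∪ τ').filter (fun k => k < i), (if k ∈ σ' then J k else J k - 1))]
  rw [← Finset.sum_subset (Finset.subset_union_left (s₁ := B.vs σ τ) (s₂ := B.us τ))]
  · refine Finset.sum_congr rfl fun r hr => ?_
    rw [if_pos hr, one_mul]
    have := B.sum_vs σ' τ' (fun k => if k < B.blk r then 1 else 0)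
    simp only [mul_ite, mul_one, mul_zero] at this
    rw [← Finset.sum_filter, ← Finset.sum_filter] at this
    rw [← this]
    have hsub : (B.vs σ' τ').filter (fun s => B.blk s < B.blk r) ⊆
        (B.vs σ' τ' ∪ B.us τ').filter (fun s => s < r) := by
      intro s hs
      simp only [Finset.mem_filter, Finset.mem_union] at hs ⊢
      refine ⟨Or.inl hs.1, ?_⟩
      by_contra h
      exact absurd hs.2 (not_lt.2 (B.mono (not_lt.1 h)))
    rw [← Finset.sum_subset hsub]
    · refine Finset.sum_congr rfl fun s hs => ?_
      rw [if_pos (Finset.mem_filter.1 hs).1]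
    · intro s hs hs'
      refine if_neg ?_
      intro hsv
      apply hs'
      rw [Finset.mem_filter]
      refine ⟨hsv, ?_⟩
      have hlt := (Finset.mem_filter.1 hs).2
      refine lt_of_le_of_ne (B.mono hlt.le) fun he => ?_
      have h3' := h3 (B.blk r)
      rw [B.J_one] at h3'
      simp only [Finset.mem_union, Finset.mem_inter] at h3'
      have h4 : B.blk r ∈ σ → B.blk r ∉ σ' := fun h => Finset.disjoint_left.1 h1 h
      have h5 : B.blk r ∈ τ → B.blk r ∉ σ' := fun h => Finset.disjoint_left.1 h2 h
      have h6 : ¬ ∀ r', B.blk r' = B.blk r → r' = B.fst (B.blk r) := by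
        intro h
        have e1 := h r rfl
        have e2 := h s he
        rw [e2, ← e1] at hlt
        exact lt_irrefl _ hlt
      rw [mem_vs] at hr hsv
      rw [he] at hsv
      tauto
  · intro r _ hr
    rw [if_neg hr]
    simp

theorem phi_mul (x y : RMod F) : B.phi (mulR F J x y) =
    mulR F' (fun _ => 1) (B.phi x) (B.phi y) := by
  have : (mulR F J).compr₂ B.phi = (mulR F' (fun _ => 1)).compl₁₂ B.phi B.phi := by
    refine Finsupp.lhom_ext' fun a => LinearMap.ext_ring ?_
    refine Finsupp.lhom_ext' fun b => LinearMap.ext_ring ?_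
    change B.phi (mulR F J (Finsupp.single a 1) (Finsupp.single b 1)) =
      mulR F' (fun _ => 1) (B.phi (Finsupp.single a 1)) (B.phi (Finsupp.single b 1))
    rw [phi_single, phi_single, mulR_single, mulMon_eq]
    obtain ⟨a', ha1, ha2⟩ := exists_idx ((B.vs_mem a.1.1 a.1.2).2 a.2.1) (B.vs_disj a.2.2)
    obtain ⟨b', hb1, hb2⟩ := exists_idx ((B.vs_mem b.1.1 b.1.2).2 b.2.1) (B.vs_disj b.2.2)
    rw [← ha1, ← ha2, ← hb1, ← hb2, mkR_idx, mkR_idx, mulR_single, mulMon_eq,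
      ha1, ha2, hb1, hb2]
    have hc := B.cond_iff a.1.1 a.1.2 b.1.1 b.1.2
    split_ifs with h h' h'
    · rw [map_smul, B.phi_mk _ _ Finset.disjoint_sdiff,
        B.sign_eq _ _ _ _ h.2.1 h.2.2.1 h.2.2.2]
      congr 2
      · ext r
        simp only [Finset.mem_union, mem_vs, Finset.mem_sdiff]
        tauto
      · ext r
        simp only [Finset.mem_union, mem_vs, mem_us, Finset.mem_sdiff]
        tauto
    · exact absurd (hc.2 h) h'
    · exact absurd (hc.1 h') h
    · exact map_zero _
  exact LinearMap.congr_fun (LinearMap.congr_fun this x) y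

theorem phi_injective : Function.Injective B.phi := by
  classical
  have hvs : ∀ b : MonIdx F, B.vs b.1.1 b.1.2 ∈ F' ∧ Disjoint (B.vs b.1.1 b.1.2) (B.us b.1.2) :=
    fun b => ⟨(B.vs_mem _ _).2 b.2.1, B.vs_disj b.2.2⟩
  let g : MonIdx F → MonIdx F' := fun b => ⟨(B.vs b.1.1 b.1.2, B.us b.1.2), hvs b⟩
  have hg : Function.Injective g := by
    intro b c h
    have h1 : B.vs b.1.1 b.1.2 = B.vs c.1.1 c.1.2 := congrArg (fun z => z.1.1) h
    have h2 : B.us b.1.2 = B.us c.1.2 := congrArg (fun z => z.1.2) h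
    apply Subtype.ext
    apply Prod.ext
    · ext i
      rw [← B.fst_mem_vs (σ := b.1.1) (τ := b.1.2), h1, fst_mem_vs]
    · ext i
      rw [← B.fst_mem_us (τ := b.1.2), h2, fst_mem_us]
  have : B.phi = Finsupp.lmapDomain ℤ ℤ g := by
    refine Finsupp.lhom_ext' fun b => LinearMap.ext_ring ?_
    change B.phi (Finsupp.single b 1) = Finsupp.mapDomain g (Finsupp.single b 1)
    rw [phi_single, Finsupp.mapDomain_single, mkR_pos (hvs b).1 (hvs b).2]
    rfl
  rw [this]
  exact Finsupp.mapDomain_injective hg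

theorem span_partSub {N : ℕ} {F : Set (Finset (Fin N))} (J : Fin N → ℕ) (p : ℕ) :
    partSub (degMon J (F := F)) p =
      Submodule.span ℤ {x : RMod F | ∃ b : MonIdx F, degMon J b = p ∧ x = Finsupp.single b 1} := by
  apply le_antisymm
  · intro x hx
    rw [← Finsupp.sum_single x]
    refine Submodule.sum_mem _ fun b hb => ?_
    have : (Finsupp.single b (x b) : RMod F) = x b • Finsupp.single b 1 := by simp
    rw [this]
    exact Submodule.smul_mem _ _ (Submodule.subset_span ⟨b, hx b hb, rfl⟩)
  · refine Submodule.span_le.2 ?_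
    rintro _ ⟨b, hb, rfl⟩ c hc
    rw [Finset.mem_singleton.1 (Finsupp.support_single_subset hc)]
    exact hb

theorem phi_partSub {p : ℕ} {x : RMod F} (hx : x ∈ partSub (degMon J) p) :
    B.phi x ∈ partSub (degMon fun _ => 1) p := by
  rw [span_partSub] at *
  have : Submodule.span ℤ {x : RMod F | ∃ b : MonIdx F, degMon J b = p ∧ x = Finsupp.single b 1}
      ≤ (Submodule.span ℤ {x : RMod F' | ∃ b : MonIdx F', degMon (fun _ => 1) b = p ∧
        x = Finsupp.single b 1}).comap B.phi := by
    refine Submodule.span_le.2 ?_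
    rintro _ ⟨b, hb, rfl⟩
    rw [SetLike.mem_coe, Submodule.mem_comap, phi_single]
    obtain ⟨b', hb1, hb2⟩ := exists_idx ((B.vs_mem b.1.1 b.1.2).2 b.2.1) (B.vs_disj b.2.2)
    rw [← hb1, ← hb2, mkR_idx]
    refine Submodule.subset_span ⟨b', ?_, rfl⟩
    rw [← hb]
    unfold degMon
    rw [hb1, ← B.card_vs _ _ b.2.2]
    simp
  exact this hx

theorem partSub_V {p : ℕ} {x : RMod F'} (hx : x ∈ partSub (degMon fun _ => 1) p) :
    x ∈ B.V (fun k => k = p) ∅ := by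
  rw [span_partSub] at hx
  refine Submodule.span_mono ?_ hx
  rintro _ ⟨b, hb, rfl⟩
  refine ⟨b.1.1, b.1.2, b.2.2, ?_, by simp, (mkR_idx b).symm⟩
  rw [← hb]
  simp [degMon]

theorem all_V (x : RMod F') : x ∈ B.V (fun _ => True) ∅ := by
  rw [← Finsupp.sum_single x]
  refine Submodule.sum_mem _ fun b hb => ?_
  have : (Finsupp.single b (x b) : RMod F') = x b • Finsupp.single b 1 := by simp
  rw [this]
  exact Submodule.smul_mem _ _ (Submodule.subset_span
    ⟨b.1.1, b.1.2, b.2.2, trivial, by simp, (mkR_idx b).symm⟩)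

theorem good_image (i : Fin m) (σ τ : Finset (Fin m)) :
    B.good i (B.vs σ τ) (B.vs σ τ ∪ B.us τ) := by
  by_cases h : i ∈ σ ∪ τ
  · right
    rintro r rfl
    simp only [Finset.mem_union, mem_vs, mem_us] at *
    tauto
  · left
    rintro r hr rfl
    simp only [Finset.mem_union, mem_vs, mem_us] at *
    tauto

theorem phi_V (x : RMod F) : B.phi x ∈ B.V (fun _ => True) univ := by
  rw [← Finsupp.sum_single x, map_finsuppSum]
  refine Submodule.sum_mem _ fun b hb => ?_
  have : (Finsupp.single b (x b) : RMod F) = x b • Finsupp.single b 1 := by simp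
  change B.phi (Finsupp.single b (x b)) ∈ _
  rw [this, map_smul, phi_single]
  exact Submodule.smul_mem _ _ (Submodule.subset_span
    ⟨_, _, B.vs_disj b.2.2, trivial, fun i _ => B.good_image i _ _, rfl⟩)

/-- good monomials are images -/
theorem exists_image (σ τ : Finset (Fin D)) (h : Disjoint σ τ)
    (hg : ∀ i, B.good i σ (σ ∪ τ)) :
    ∃ σ0 τ0, Disjoint σ0 τ0 ∧ σ = B.vs σ0 τ0 ∧ τ = B.us τ0 := by
  refine ⟨univ.filter fun i => B.fst i ∈ σ, univ.filter fun i => B.fst i ∈ τ, ?_, ?_, ?_⟩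
  · rw [Finset.disjoint_left] at *
    intro i hi hi'
    simp only [Finset.mem_filter, Finset.mem_univ, true_and] at *
    exact h hi hi'
  · ext r
    simp only [mem_vs, Finset.mem_filter, Finset.mem_univ, true_and]
    have hd := Finset.disjoint_left.1 h
    by_cases hr : r = B.fst (B.blk r)
    · rw [← hr]
      simp
    · rcases hg (B.blk r) with h' | h'
      · have h1 : r ∉ σ := fun hh => h' r (Finset.mem_union_left _ hh) rfl
        have h2 : B.fst (B.blk r) ∉ σ ∪ τ := fun hh => h' _ hh (B.blk_fst _)
        rw [Finset.mem_union] at h2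
        tauto
      · have h1 := (h' r rfl).2 hr
        have h2 := (h' _ (B.blk_fst (B.blk r))).1
        rw [Finset.mem_union] at h2
        tauto
  · ext r
    simp only [mem_us, Finset.mem_filter, Finset.mem_univ, true_and]
    constructor
    · intro hr
      have : r = B.fst (B.blk r) := by
        by_contra hne
        rcases hg (B.blk r) with h' | h'
        · exact h' r (Finset.mem_union_right _ hr) rfl
        · exact Finset.disjoint_left.1 h ((h' r rfl).2 hne) hr
      rw [← this]
      exact ⟨hr, rfl⟩
    · rintro ⟨h1, h2⟩
      rwa [h2]

theorem V_image {Q : ℕ → Prop} {x : RMod F'} (hx : x ∈ B.V Q univ) :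
    ∃ y ∈ Submodule.span ℤ {x : RMod F | ∃ b : MonIdx F, Q (degMon J b) ∧
      x = Finsupp.single b 1}, B.phi y = x := by
  have : B.V Q univ ≤ (Submodule.span ℤ {x : RMod F | ∃ b : MonIdx F, Q (degMon J b) ∧
      x = Finsupp.single b 1}).map B.phi := by
    refine Submodule.span_le.2 ?_
    rintro _ ⟨σ, τ, h, hQ, hg, rfl⟩
    by_cases hσ : σ ∈ F'
    · obtain ⟨σ0, τ0, h0, rfl, rfl⟩ := B.exists_image σ τ h (fun i => hg i (Finset.mem_univ _))
      rw [B.vs_mem] at hσ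
      obtain ⟨b, rfl, rfl⟩ := exists_idx hσ h0
      refine ⟨Finsupp.single b 1, Submodule.subset_span ⟨b, ?_, rfl⟩, B.phi_single b⟩
      rw [B.card_vs _ _ h0] at hQ
      exact hQ
    · rw [mkR_of_notMem hσ]
      exact Submodule.zero_mem _
  exact this hx

theorem phi_one (h : ∅ ∈ F) : B.phi (oneR F) = oneR F' := by
  have e : ∀ {N : ℕ} (F : Set (Finset (Fin N))), ∅ ∈ F → oneR F = mkR F ∅ ∅ := by
    intro N F h
    rw [mkR_pos h (Finset.disjoint_empty_left _)]
    exact dif_pos h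
  have h1 : B.vs ∅ ∅ = ∅ := by
    ext r
    simp [mem_vs]
  have h2 : B.us ∅ = ∅ := by
    ext r
    simp [mem_us]
  have h3 : ∅ ∈ F' := by
    rw [← h1, B.vs_mem]
    exact h
  rw [e F h, e F' h3, B.phi_mk _ _ (Finset.disjoint_empty_left _), h1, h2]

end BData

theorem mem_iff_missing {m : ℕ} (K : ASC m) (σ : Finset (Fin m)) :
    σ ∈ K.faces ↔ ∀ τ, IsMissingFace K τ → ¬ τ ⊆ σ := by
  constructor
  · exact fun h τ hτ hs => hτ.1 (K.down_closed h hs)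
  · intro h
    by_contra hσ
    induction σ using Finset.strongInduction with
    | H σ ih =>
      by_cases hm : ∀ s ⊂ σ, s ∈ K.faces
      · exact h σ ⟨hσ, hm⟩ (Finset.Subset.refl _)
      · push Not at hm
        obtain ⟨s, hs, hsK⟩ := hm
        exact ih s hs (fun τ hτ hτs => h τ hτ (hτs.trans hs.subset)) hsK

theorem sum_Iic_eq {m : ℕ} (J : Fin m → ℕ) (i : Fin m) :
    ∑ k ∈ Finset.Iic i, J k = ∑ k ∈ Finset.Iio i, J k + J i := by
  rw [← Finset.Iio_insert, Finset.sum_insert (by simp), add_comm]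

theorem sum_Iic_le {m : ℕ} (J : Fin m → ℕ) (i : Fin m) :
    ∑ k ∈ Finset.Iic i, J k ≤ dJ J :=
  Finset.sum_le_sum_of_subset (Finset.subset_univ _)

theorem sum_Iic_le_Iio {m : ℕ} (J : Fin m → ℕ) {i k : Fin m} (h : i < k) :
    ∑ l ∈ Finset.Iic i, J l ≤ ∑ l ∈ Finset.Iio k, J l :=
  Finset.sum_le_sum_of_subset fun l hl => Finset.mem_Iio.2 ((Finset.mem_Iic.1 hl).trans_lt h)

theorem mem_Bblk {m : ℕ} (J : Fin m → ℕ) (i : Fin m) (r : Fin (dJ J)) :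
    r ∈ Bblk J i ↔ (∑ k ∈ Finset.Iio i, J k) ≤ (r : ℕ) ∧ (r : ℕ) < ∑ k ∈ Finset.Iic i, J k := by
  simp [Bblk]

theorem exists_blk {m : ℕ} (J : Fin m → ℕ) (r : Fin (dJ J)) : ∃ i, r ∈ Bblk J i := by
  have hne : ((univ : Finset (Fin m)).filter
      fun i => (r : ℕ) < ∑ k ∈ Finset.Iic i, J k).Nonempty := by
    rcases m with _ | m
    · have := r.2
      simp [dJ] at this
    · refine ⟨Fin.last m, ?_⟩
      rw [Finset.mem_filter]
      refine ⟨Finset.mem_univ _, ?_⟩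
      have : Finset.Iic (Fin.last m) = univ := by
        ext k
        simp [Fin.le_last]
      rw [this]
      exact r.2
  refine ⟨Finset.min' _ hne, ?_⟩
  have h1 := Finset.min'_mem _ hne
  rw [mem_Bblk]
  refine ⟨?_, (Finset.mem_filter.1 h1).2⟩
  generalize hi : Finset.min' _ hne = i at *
  by_contra hlt
  rw [not_le] at hlt
  rcases Nat.eq_zero_or_pos (i : ℕ) with h0 | h0
  · have : Finset.Iio i = ∅ := by
      ext k
      simp [Fin.lt_def, h0]
    rw [this] at hlt
    simp at hlt
  · let k : Fin m := ⟨i - 1, by omega⟩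
    have hk : Finset.Iio i = Finset.Iic k := by
      ext l
      simp only [Finset.mem_Iio, Finset.mem_Iic, Fin.lt_def, Fin.le_def, k]
      omega
    rw [hk] at hlt
    have := Finset.min'_le (univ.filter fun i => (r : ℕ) < ∑ k ∈ Finset.Iic i, J k) k
      (by simp [hlt])
    rw [hi, Fin.le_def] at this
    simp only [k] at this
    omega

theorem exists_BData {m : ℕ} (K : ASC m) (J : Fin m → ℕ) (hJ : ∀ i, 1 ≤ J i) :
    Nonempty (BData J K.faces (KJfaces K J)) := by
  choose blk hblk using exists_blk J
  have hle : ∀ i k r, r ∈ Bblk J i → r ∈ Bblk J k → i ≤ k := by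
    intro i k r hi hk
    by_contra h
    have := sum_Iic_le_Iio J (not_le.1 h)
    rw [mem_Bblk] at hi hk
    omega
  have huniq : ∀ i r, blk r = i ↔ r ∈ Bblk J i := by
    intro i r
    constructor
    · rintro rfl
      exact hblk r
    · exact fun h => le_antisymm (hle _ _ r (hblk r) h) (hle _ _ r h (hblk r))
  have hlt : ∀ i, ∑ k ∈ Finset.Iio i, J k < dJ J := by
    intro i
    have h1 := sum_Iic_le J i
    have h2 := sum_Iic_eq J i
    have h3 := hJ i
    omega
  refine ⟨⟨blk, fun i => ⟨_, hlt i⟩, ?_, ?_, ?_, ?_, fun σ τ h hs => K.down_closed h hs, ?_⟩⟩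
  · intro r s hrs
    by_contra h
    have h0 := sum_Iic_le_Iio J (not_le.1 h)
    have h1 := hblk r
    have h2 := hblk s
    rw [mem_Bblk] at h1 h2
    have := Fin.le_def.1 hrs
    omega
  · intro i
    rw [huniq, mem_Bblk]
    have h2 := sum_Iic_eq J i
    have h3 := hJ i
    simp only
    omega
  · intro r
    exact ((mem_Bblk _ _ _).1 (hblk r)).1
  · intro i
    have e : (univ.filter fun r => blk r = i).map Fin.valEmbedding =
        Finset.Ico (∑ k ∈ Finset.Iio i, J k) (∑ k ∈ Finset.Iic i, J k) := by
      ext x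
      simp only [Finset.mem_map, Finset.mem_filter, Finset.mem_univ, true_and, Finset.mem_Ico,
        huniq, mem_Bblk, Fin.valEmbedding_apply]
      constructor
      · rintro ⟨r, hr, rfl⟩
        exact hr
      · intro h
        exact ⟨⟨x, h.2.trans_le (sum_Iic_le J i)⟩, h, rfl⟩
    rw [← Finset.card_map Fin.valEmbedding, e, Nat.card_Ico, sum_Iic_eq]
    omega
  · intro σ
    rw [mem_iff_missing]
    change (∀ τ : Finset (Fin m), IsMissingFace K τ → ¬ (τ.biUnion (Bblk J) ⊆ σ)) ↔ _
    refine forall_congr' fun τ => imp_congr_right fun _ => not_congr ?_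
    constructor
    · intro h i hi
      rw [Finset.mem_filter]
      refine ⟨Finset.mem_univ _, fun r hr => h (Finset.mem_biUnion.2 ⟨i, hi, ?_⟩)⟩
      rwa [← huniq]
    · intro h r hr
      obtain ⟨i, hi, hri⟩ := Finset.mem_biUnion.1 hr
      exact (Finset.mem_filter.1 (h hi)).2 r ((huniq _ _).2 hri)

end helpers

/-- the cohomology of `R*_K(J)` and of `R*_{K(J)} = R*_{K(J)}(𝟏)`
are isomorphic as graded rings.  The isomorphism is encoded by a degreewise
correspondence `f` on cocycles which descends to a bijection on cohomology in each
degree and is additive, multiplicative and unital up to coboundaries. -/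
theorem stmt1 {m : ℕ} (K : ASC m) (J : Fin m → ℕ) (hJ : ∀ i, 1 ≤ J i) :
    ∃ f : ℕ → RMod K.faces → RMod (KJfaces K J),
      -- f preserves degrees and cocycles
      (∀ (p : ℕ) (x), x ∈ partSub (degMon J) p → dR K.faces J x = 0 →
        f p x ∈ partSub (degMon fun _ => 1) p ∧ dR (KJfaces K J) (fun _ => 1) (f p x) = 0) ∧
      -- f descends to a well-defined injective map on cohomology in each degree
      (∀ (p : ℕ) (x y), x ∈ partSub (degMon J) p → y ∈ partSub (degMon J) p →
        dR K.faces J x = 0 → dR K.faces J y = 0 →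
        ((∃ z, x - y = dR K.faces J z) ↔
          (∃ w, f p x - f p y = dR (KJfaces K J) (fun _ => 1) w))) ∧
      -- additive up to coboundaries
      (∀ (p : ℕ) (x y), x ∈ partSub (degMon J) p → y ∈ partSub (degMon J) p →
        dR K.faces J x = 0 → dR K.faces J y = 0 →
        ∃ w, f p (x + y) - (f p x + f p y) = dR (KJfaces K J) (fun _ => 1) w) ∧
      -- surjective on cohomology in each degree
      (∀ (p : ℕ) (y), y ∈ partSub (degMon fun _ => 1) p →
        dR (KJfaces K J) (fun _ => 1) y = 0 →
        ∃ x, x ∈ partSub (degMon J) p ∧ dR K.faces J x = 0 ∧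
          ∃ w, f p x - y = dR (KJfaces K J) (fun _ => 1) w) ∧
      -- multiplicative up to coboundaries
      (∀ (p q : ℕ) (x y), x ∈ partSub (degMon J) p → y ∈ partSub (degMon J) q →
        dR K.faces J x = 0 → dR K.faces J y = 0 →
        ∃ w, f (p + q) (mulR K.faces J x y) -
          mulR (KJfaces K J) (fun _ => 1) (f p x) (f q y) =
            dR (KJfaces K J) (fun _ => 1) w) ∧
      -- unital up to coboundaries
      (∃ w, f 0 (oneR K.faces) - oneR (KJfaces K J) = dR (KJfaces K J) (fun _ => 1) w) := by
  obtain ⟨B⟩ := exists_BData K J hJ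
  refine ⟨fun _ => B.phi, ?_, ?_, ?_, ?_, ?_, ?_⟩
  · intro p x hx hd
    refine ⟨B.phi_partSub hx, ?_⟩
    rw [B.phi_dR, hd, map_zero]
  · intro p x y hx hy hdx hdy
    constructor
    · rintro ⟨z, hz⟩
      refine ⟨B.phi z, ?_⟩
      rw [B.phi_dR, ← hz, map_sub]
    · rintro ⟨w, hw⟩
      obtain ⟨w', hw'⟩ := B.retract (Q' := fun _ => True) (B.all_V w) (by
        rw [← hw, ← map_sub]
        exact B.phi_V _)
      obtain ⟨z, -, hz⟩ := B.V_image hw'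
      refine ⟨z, B.phi_injective ?_⟩
      rw [← B.phi_dR, hz, map_sub, map_sub, dR_dR _ B.down', sub_zero, hw]
  · intro p x y _ _ _ _
    exact ⟨0, by beta_reduce; rw [map_add, sub_self, map_zero]⟩
  · intro p y hy hdy
    obtain ⟨w, hw⟩ := B.retract (Q' := fun _ => True) (B.partSub_V hy) (by
      rw [hdy]
      exact Submodule.zero_mem _)
    obtain ⟨x, hx, hxy⟩ := B.V_image hw
    refine ⟨x, ?_, B.phi_injective ?_, -w, ?_⟩
    · rw [BData.span_partSub]
      exact hx
    · rw [← B.phi_dR, hxy, map_sub, dR_dR _ B.down', hdy, sub_zero, map_zero]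
    · beta_reduce
      rw [hxy, map_neg]
      abel
  · intro p q x y _ _ _ _
    exact ⟨0, by beta_reduce; rw [B.phi_mul, sub_self, map_zero]⟩
  · exact ⟨0, by beta_reduce; rw [B.phi_one K.empty_mem, sub_self, map_zero]⟩
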